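/- In the embedded-hyperbolic-plane setting, the set {x_+(t) : t > 0} ∪ {x_−(t) : t > 0} generates the restricted transvection group Trans(X)|_ℍ, i.e., the subgroup of the group of bijections of X generated by {s_{f(g)} ∘ s_o : g ∈ SL(2,ℝ)}. -/

import Mathlib

open Matrix

/-- `SL(2,ℝ)`. -/
abbrev SL2 := Matrix.SpecialLinearGroup (Fin 2) ℝ

/-- The transpose, as a map `SL(2,ℝ) → SL(2,ℝ)`. -/
def transpSL (g : SL2) : SL2 :=
  ⟨(g : Matrix (Fin 2) (Fin 2) ℝ)ᵀ, by rw [Matrix.det_transpose]; exact g.2⟩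

/-- The Cartan--Chevalley involution `θ(g) = (gᵀ)⁻¹` of `SL(2,ℝ)`. -/
def thetaSL (g : SL2) : SL2 := (transpSL g)⁻¹

/-- The twist map `τ(g) = g gᵀ` of `SL(2,ℝ)`. -/
def tauSL (g : SL2) : SL2 := g * transpSL g

noncomputable def Amat (t : ℝ) : Matrix (Fin 2) (Fin 2) ℝ :=
  (Real.sqrt 2)⁻¹ • !![3 * t, -1; -1, 1 / t]

noncomputable def Bmat (t : ℝ) : Matrix (Fin 2) (Fin 2) ℝ :=
  !![1 / t, 1; 1, 2 * t]

noncomputable def Cmat : Matrix (Fin 2) (Fin 2) ℝ :=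
  !![(Real.sqrt 2)⁻¹, 0; 0, Real.sqrt 2]

/-- The upper shear matrix `[[1,t],[0,1]]` as an element of `SL(2,ℝ)`. -/
def shearU (t : ℝ) : SL2 := ⟨!![1, t; 0, 1], by simp [Matrix.det_fin_two_of]⟩

/-- The lower shear matrix `[[1,0],[t,1]]` as an element of `SL(2,ℝ)`. -/
def shearL (t : ℝ) : SL2 := ⟨!![1, 0; t, 1], by simp [Matrix.det_fin_two_of]⟩

/-- The elementary reflection `s_x : y ↦ x.y` of a reflection space, as a permutation;
it is an involutive bijection by (RS2). -/
def elemRefl {X : Type*} (μ : X → X → X) (rs2 : ∀ x y, μ x (μ x y) = y) (x : X) :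
    Equiv.Perm X :=
  ⟨μ x, μ x, rs2 x, rs2 x⟩

/-- The elementary transvection `tr_{f(g)} = s_{f(g)} ∘ s_o`. -/
def trv {X : Type*} (μ : X → X → X) (rs2 : ∀ x y, μ x (μ x y) = y) (o : X)
    (f : SL2 → X) (g : SL2) : Equiv.Perm X :=
  elemRefl μ rs2 (f g) * elemRefl μ rs2 o

/-- `x_+(t) = tr_{f(a(t))} ∘ tr_{f(b(t))} ∘ tr_{f(c)}`. -/
def xplus {X : Type*} (μ : X → X → X) (rs2 : ∀ x y, μ x (μ x y) = y) (o : X)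
    (f : SL2 → X) (a b : ℝ → SL2) (c : SL2) (t : ℝ) : Equiv.Perm X :=
  trv μ rs2 o f (a t) * trv μ rs2 o f (b t) * trv μ rs2 o f c

/-- `x_−(t) = tr_{f(c)} ∘ tr_{f(b(t))} ∘ tr_{f(a(t))}`. -/
def xminus {X : Type*} (μ : X → X → X) (rs2 : ∀ x y, μ x (μ x y) = y) (o : X)
    (f : SL2 → X) (a b : ℝ → SL2) (c : SL2) (t : ℝ) : Equiv.Perm X :=
  trv μ rs2 o f c * trv μ rs2 o f (b t) * trv μ rs2 o f (a t)

/-- The automorphisms of a reflection space, as a subgroup of the permutation group. -/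
def reflAut {X : Type*} (μ : X → X → X) : Subgroup (Equiv.Perm X) where
  carrier := {p | ∀ y z, p (μ y z) = μ (p y) (p z)}
  one_mem' := fun _ _ => rfl
  mul_mem' := by
    intro p q hp hq y z
    simp only [Set.mem_ofPred_eq] at hp hq
    simp [hp, hq]
  inv_mem' := by
    intro p hp y z
    simp only [Set.mem_ofPred_eq] at hp
    rw [Equiv.Perm.inv_eq_iff_eq, hp]
    simp

section ReflectionSpace

variable {X : Type*} {μ : X → X → X} (rs2 : ∀ x y, μ x (μ x y) = y)

theorem elemRefl_apply (x y : X) : elemRefl μ rs2 x y = μ x y := rfl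

theorem elemRefl_inv (x : X) : (elemRefl μ rs2 x)⁻¹ = elemRefl μ rs2 x := rfl

theorem elemRefl_mem_reflAut (rs3 : ∀ x y z, μ x (μ y z) = μ (μ x y) (μ x z)) (x : X) :
    elemRefl μ rs2 x ∈ reflAut μ :=
  fun y z => rs3 x y z

/-- Automorphisms permute the elementary reflections by conjugation. -/
theorem mul_elemRefl_of_mem_reflAut {p : Equiv.Perm X} (hp : p ∈ reflAut μ) (x : X) :
    p * elemRefl μ rs2 x = elemRefl μ rs2 (p x) * p := by
  ext y
  exact hp x y

/-- An automorphism fixing `x` commutes with the reflection at `x`. -/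
theorem commute_elemRefl_of_mem_reflAut {p : Equiv.Perm X} (hp : p ∈ reflAut μ) {x : X}
    (hx : p x = x) : Commute p (elemRefl μ rs2 x) := by
  have h := mul_elemRefl_of_mem_reflAut rs2 hp x
  rwa [hx] at h

/-- If `h`, `r` and the reflection at `o` are such that `h` and `r⁻¹ s_o` commute, then
`s_{h o} s_o` is the commutator of `h` and `r`. -/
theorem elemRefl_mul_elemRefl_eq_commutator {h r : Equiv.Perm X} {o : X} (hh : h ∈ reflAut μ)
    (hr : Commute h (r⁻¹ * elemRefl μ rs2 o)) :
    elemRefl μ rs2 (h o) * elemRefl μ rs2 o = h * r * h⁻¹ * r⁻¹ := by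
  have h1 := mul_elemRefl_of_mem_reflAut rs2 hh o
  have h2 : elemRefl μ rs2 (h o) = h * elemRefl μ rs2 o * h⁻¹ := by rw [h1]; group
  have h3 : elemRefl μ rs2 o * elemRefl μ rs2 o = 1 := by
    nth_rewrite 1 [← elemRefl_inv]
    exact inv_mul_cancel _
  have h4 : elemRefl μ rs2 o * h⁻¹ = r * h⁻¹ * r⁻¹ * elemRefl μ rs2 o := by
    have := hr.inv_left.eq
    calc elemRefl μ rs2 o * h⁻¹ = r * ((r⁻¹ * elemRefl μ rs2 o) * h⁻¹) := by group
      _ = r * (h⁻¹ * (r⁻¹ * elemRefl μ rs2 o)) := by rw [this]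
      _ = _ := by group
  calc elemRefl μ rs2 (h o) * elemRefl μ rs2 o
      = h * (elemRefl μ rs2 o * h⁻¹) * elemRefl μ rs2 o := by rw [h2]; group
    _ = h * r * h⁻¹ * r⁻¹ * (elemRefl μ rs2 o * elemRefl μ rs2 o) := by rw [h4]; group
    _ = _ := by rw [h3, mul_one]

end ReflectionSpace

/-- The elements of `SL(2,ℝ)` whose left translation on the image of `f` is induced by an
element of `H`. -/
def translatedBy {X : Type*} (f : SL2 → X) (H : Subgroup (Equiv.Perm X)) : Subgroup SL2 where
  carrier := {g | ∃ p ∈ H, ∀ k, p (f k) = f (g * k)}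
  one_mem' := ⟨1, H.one_mem, fun k => by simp⟩
  mul_mem' := by
    rintro g g' ⟨p, hp, hpg⟩ ⟨q, hq, hqg⟩
    exact ⟨p * q, H.mul_mem hp hq, fun k => by simp [hpg, hqg, mul_assoc]⟩
  inv_mem' := by
    rintro g ⟨p, hp, hpg⟩
    refine ⟨p⁻¹, H.inv_mem hp, fun k => ?_⟩
    rw [Equiv.Perm.inv_eq_iff_eq, hpg]
    simp

theorem shearU_coe (t : ℝ) : (shearU t : Matrix (Fin 2) (Fin 2) ℝ) = !![1, t; 0, 1] := rfl

theorem shearL_coe (t : ℝ) : (shearL t : Matrix (Fin 2) (Fin 2) ℝ) = !![1, 0; t, 1] := rfl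

theorem transpSL_coe (g : SL2) :
    (transpSL g : Matrix (Fin 2) (Fin 2) ℝ) = (g : Matrix (Fin 2) (Fin 2) ℝ)ᵀ := rfl

/-- `SL(2,ℝ)` is generated by the shears with positive parameter. -/
theorem mem_of_forall_shear_mem (Q : Subgroup SL2) (hU : ∀ t : ℝ, 0 < t → shearU t ∈ Q)
    (hL : ∀ t : ℝ, 0 < t → shearL t ∈ Q) (g : SL2) : g ∈ Q := by
  have hU' : ∀ t : ℝ, shearU t ∈ Q := by
    intro t
    rcases lt_trichotomy t 0 with ht | rfl | ht
    · have h : shearU t = (shearU (-t))⁻¹ := by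
        rw [eq_inv_iff_mul_eq_one]
        ext i j
        fin_cases i <;> fin_cases j <;> simp [shearU_coe]
      rw [h]
      exact Q.inv_mem (hU _ (by linarith))
    · have h : shearU 0 = 1 := by
        ext i j
        fin_cases i <;> fin_cases j <;> simp [shearU_coe]
      rw [h]
      exact Q.one_mem
    · exact hU t ht
  have hL' : ∀ t : ℝ, shearL t ∈ Q := by
    intro t
    rcases lt_trichotomy t 0 with ht | rfl | ht
    · have h : shearL t = (shearL (-t))⁻¹ := by
        rw [eq_inv_iff_mul_eq_one]
        ext i j
        fin_cases i <;> fin_cases j <;> simp [shearL_coe]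
      rw [h]
      exact Q.inv_mem (hL _ (by linarith))
    · have h : shearL 0 = 1 := by
        ext i j
        fin_cases i <;> fin_cases j <;> simp [shearL_coe]
      rw [h]
      exact Q.one_mem
    · exact hL t ht
  have key : ∀ g : SL2, g 1 0 ≠ 0 → g ∈ Q := by
    intro g hg
    have hdet := g.2
    rw [Matrix.det_fin_two] at hdet
    have h : g = shearU ((g 0 0 - 1) / g 1 0) * shearL (g 1 0)
        * shearU ((g 1 1 - 1) / g 1 0) := by
      ext i j
      fin_cases i <;> fin_cases j <;> simp [shearU_coe, shearL_coe, Matrix.mul_apply, Fin.sum_univ_two]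
        <;> field_simp <;> first | ring1 | linear_combination -hdet
    rw [h]
    exact Q.mul_mem (Q.mul_mem (hU' _) (hL' _)) (hU' _)
  by_cases hg : g 1 0 = 0
  · have hdet := g.2
    rw [Matrix.det_fin_two, hg] at hdet
    have h0 : g 0 0 ≠ 0 := by
      intro h
      rw [h] at hdet
      simp at hdet
    have h1 : shearL 1 * g ∈ Q := by
      apply key
      simpa [shearL_coe, Matrix.mul_apply, Fin.sum_univ_two, hg] using h0
    exact (Q.mul_mem_cancel_left (hL' 1)).1 h1
  · exact key g hg

theorem tauSL_coe_of_posDef {g : SL2} {S : Matrix (Fin 2) (Fin 2) ℝ}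
    (hg : (g : Matrix (Fin 2) (Fin 2) ℝ).PosDef)
    (hS : (g : Matrix (Fin 2) (Fin 2) ℝ) * (g : Matrix (Fin 2) (Fin 2) ℝ) = S) :
    (tauSL g : Matrix (Fin 2) (Fin 2) ℝ) = S := by
  have h : (g : Matrix (Fin 2) (Fin 2) ℝ)ᵀ = g := by
    simpa [Matrix.IsHermitian, Matrix.conjTranspose_eq_transpose_of_trivial] using hg.isHermitian
  rw [← hS]
  change (g : Matrix (Fin 2) (Fin 2) ℝ) * (g : Matrix (Fin 2) (Fin 2) ℝ)ᵀ = _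
  rw [h]

theorem thetaSL_thetaSL (g : SL2) : thetaSL (thetaSL g) = g := by
  ext i j
  fin_cases i <;> fin_cases j <;>
    simp [thetaSL, transpSL_coe, Matrix.SpecialLinearGroup.coe_inv, Matrix.adjugate_fin_two]

theorem tauSL_one : tauSL 1 = 1 := by
  apply Subtype.ext
  simp [tauSL, transpSL_coe]

/-- Rotation by a right angle. -/
def rotJ : SL2 := ⟨!![0, -1; 1, 0], by simp [Matrix.det_fin_two_of]⟩

theorem rotJ_coe : (rotJ : Matrix (Fin 2) (Fin 2) ℝ) = !![0, -1; 1, 0] := rfl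

theorem tauSL_rotJ_inv : tauSL rotJ⁻¹ = 1 := by
  ext i j
  fin_cases i <;> fin_cases j <;>
    simp [tauSL, rotJ_coe, transpSL_coe, Matrix.SpecialLinearGroup.coe_inv, Matrix.adjugate_fin_two,
      Matrix.vecMul, dotProduct, Fin.sum_univ_two]

theorem thetaSL_eq_conj_rotJ (g : SL2) : thetaSL g = rotJ * g * rotJ⁻¹ := by
  ext i j
  fin_cases i <;> fin_cases j <;>
    simp [thetaSL, rotJ_coe, transpSL_coe, Matrix.SpecialLinearGroup.coe_inv, Matrix.adjugate_fin_two,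
      Matrix.mul_apply, Matrix.vecMul, dotProduct, Fin.sum_univ_two]

theorem Amat_mul_Bmat_mul_Cmat {t : ℝ} (ht : 0 < t) :
    Amat t * Bmat t * Cmat = !![1, t; 0, 1] := by
  have h0 : Real.sqrt 2 ≠ 0 := by positivity
  ext i j
  fin_cases i <;> fin_cases j <;>
    simp [Amat, Bmat, Cmat, Matrix.mul_apply, Fin.sum_univ_two] <;> field_simp <;>
    norm_num

theorem Cmat_mul_Bmat_mul_Amat {t : ℝ} (ht : 0 < t) :
    Cmat * Bmat t * Amat t = !![1, 0; t, 1] := by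
  have h : (Cmat * Bmat t * Amat t) = (Amat t * Bmat t * Cmat)ᵀ := by
    have hA : (Amat t)ᵀ = Amat t := by
      ext i j
      fin_cases i <;> fin_cases j <;> simp [Amat]
    have hB : (Bmat t)ᵀ = Bmat t := by
      ext i j
      fin_cases i <;> fin_cases j <;> simp [Bmat]
    have hC : Cmatᵀ = Cmat := by
      ext i j
      fin_cases i <;> fin_cases j <;> simp [Cmat]
    rw [Matrix.transpose_mul, Matrix.transpose_mul, hA, hB, hC, Matrix.mul_assoc]
  rw [h, Amat_mul_Bmat_mul_Cmat ht]
  ext i j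
  fin_cases i <;> fin_cases j <;> simp

/-- In the embedded-hyperbolic-plane setting, the set
`{x_+(t) : t > 0} ∪ {x_−(t) : t > 0}` generates the restricted transvection group
`Trans(X)|_ℍ`, i.e. the subgroup of the permutation group of `X` generated by
`{s_{f(g)} ∘ s_o : g ∈ SL(2,ℝ)}`. -/
theorem xplus_xminus_generate {X : Type*} (μ : X → X → X)
    (rs1 : ∀ x, μ x x = x)
    (rs2 : ∀ x y, μ x (μ x y) = y)
    (rs3 : ∀ x y z, μ x (μ y z) = μ (μ x y) (μ x z))
    (o : X) (f : SL2 → X)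
    (hf1 : f 1 = o)
    (hfK : ∀ g h : SL2, f g = f h ↔ (g⁻¹ * h) * transpSL (g⁻¹ * h) = 1)
    (hfμ : ∀ g h : SL2, f (tauSL g * thetaSL h) = μ (f g) (f h))
    (a b : ℝ → SL2) (c : SL2)
    (ha : ∀ t : ℝ, 0 < t → ((a t : Matrix (Fin 2) (Fin 2) ℝ)).PosDef ∧
      (a t : Matrix (Fin 2) (Fin 2) ℝ) * (a t : Matrix (Fin 2) (Fin 2) ℝ) = Amat t)
    (hb : ∀ t : ℝ, 0 < t → ((b t : Matrix (Fin 2) (Fin 2) ℝ)).PosDef ∧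
      (b t : Matrix (Fin 2) (Fin 2) ℝ) * (b t : Matrix (Fin 2) (Fin 2) ℝ) = Bmat t)
    (hc : ((c : Matrix (Fin 2) (Fin 2) ℝ)).PosDef ∧
      (c : Matrix (Fin 2) (Fin 2) ℝ) * (c : Matrix (Fin 2) (Fin 2) ℝ) = Cmat) :
    Subgroup.closure
      {p : Equiv.Perm X | ∃ t : ℝ, 0 < t ∧
        (p = xplus μ rs2 o f a b c t ∨ p = xminus μ rs2 o f a b c t)}
      = Subgroup.closure
        {p : Equiv.Perm X | ∃ g : SL2, p = elemRefl μ rs2 (f g) * elemRefl μ rs2 o} := by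
  have htrv : ∀ g k, trv μ rs2 o f g (f k) = f (tauSL g * k) := by
    intro g k
    change μ (f g) (μ o (f k)) = _
    rw [← hf1, ← hfμ, tauSL_one, one_mul, ← hfμ, thetaSL_thetaSL]
  have hJ : ∀ k, μ o (f k) = f (rotJ * k) := by
    intro k
    rw [← hf1, ← hfμ, tauSL_one, one_mul, thetaSL_eq_conj_rotJ, eq_comm, hfK,
      inv_mul_cancel_left]
    exact tauSL_rotJ_inv
  have hU : ∀ t : ℝ, 0 < t → tauSL (a t) * tauSL (b t) * tauSL c = shearU t := by
    intro t ht
    apply Subtype.ext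
    rw [Matrix.SpecialLinearGroup.coe_mul, Matrix.SpecialLinearGroup.coe_mul,
      tauSL_coe_of_posDef (ha t ht).1 (ha t ht).2, tauSL_coe_of_posDef (hb t ht).1 (hb t ht).2,
      tauSL_coe_of_posDef hc.1 hc.2]
    exact Amat_mul_Bmat_mul_Cmat ht
  have hL : ∀ t : ℝ, 0 < t → tauSL c * tauSL (b t) * tauSL (a t) = shearL t := by
    intro t ht
    apply Subtype.ext
    rw [Matrix.SpecialLinearGroup.coe_mul, Matrix.SpecialLinearGroup.coe_mul,
      tauSL_coe_of_posDef (ha t ht).1 (ha t ht).2, tauSL_coe_of_posDef (hb t ht).1 (hb t ht).2,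
      tauSL_coe_of_posDef hc.1 hc.2]
    exact Cmat_mul_Bmat_mul_Amat ht
  apply le_antisymm
  · rw [Subgroup.closure_le]
    have hmem : ∀ g, trv μ rs2 o f g ∈ Subgroup.closure
        {p : Equiv.Perm X | ∃ g : SL2, p = elemRefl μ rs2 (f g) * elemRefl μ rs2 o} :=
      fun g => Subgroup.subset_closure ⟨g, rfl⟩
    rintro p ⟨t, -, rfl | rfl⟩
    · exact mul_mem (mul_mem (hmem _) (hmem _)) (hmem _)
    · exact mul_mem (mul_mem (hmem _) (hmem _)) (hmem _)
  · rw [Subgroup.closure_le]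
    set H := Subgroup.closure {p : Equiv.Perm X | ∃ t : ℝ, 0 < t ∧
        (p = xplus μ rs2 o f a b c t ∨ p = xminus μ rs2 o f a b c t)} with hH
    have hsurj : ∀ g, g ∈ translatedBy f H := by
      refine mem_of_forall_shear_mem _ (fun t ht => ?_) (fun t ht => ?_)
      · refine ⟨_, Subgroup.subset_closure ⟨t, ht, Or.inl rfl⟩, fun k => ?_⟩
        simp [xplus, htrv, ← hU t ht, mul_assoc]
      · refine ⟨_, Subgroup.subset_closure ⟨t, ht, Or.inr rfl⟩, fun k => ?_⟩
        simp [xminus, htrv, ← hL t ht, mul_assoc]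
    have hs := elemRefl_mem_reflAut rs2 rs3
    have hAut : H ≤ reflAut μ := by
      rw [hH, Subgroup.closure_le]
      have htr : ∀ g, trv μ rs2 o f g ∈ reflAut μ := fun g => mul_mem (hs _) (hs _)
      rintro p ⟨t, -, rfl | rfl⟩
      · exact mul_mem (mul_mem (htr _) (htr _)) (htr _)
      · exact mul_mem (mul_mem (htr _) (htr _)) (htr _)
    obtain ⟨r, hrH, hr⟩ := hsurj rotJ
    have hz : r⁻¹ * elemRefl μ rs2 o ∈ reflAut μ := mul_mem (inv_mem (hAut hrH)) (hs o)
    have hzfix : ∀ g, (r⁻¹ * elemRefl μ rs2 o) (f g) = f g := by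
      intro g
      rw [Equiv.Perm.mul_apply, Equiv.Perm.inv_eq_iff_eq, hr, elemRefl_apply, hJ]
    have hcent : H ≤ Subgroup.centralizer {r⁻¹ * elemRefl μ rs2 o} := by
      rw [hH, Subgroup.closure_le]
      have hC : ∀ g, elemRefl μ rs2 (f g) ∈
          Subgroup.centralizer {r⁻¹ * elemRefl μ rs2 o} := by
        intro g
        rw [Subgroup.mem_centralizer_singleton_iff]
        exact (commute_elemRefl_of_mem_reflAut rs2 hz (hzfix g)).eq.symm
      have htr : ∀ g, trv μ rs2 o f g ∈ Subgroup.centralizer {r⁻¹ * elemRefl μ rs2 o} :=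
        fun g => mul_mem (hC g) (hf1 ▸ hC 1)
      rintro p ⟨t, -, rfl | rfl⟩
      · exact mul_mem (mul_mem (htr _) (htr _)) (htr _)
      · exact mul_mem (mul_mem (htr _) (htr _)) (htr _)
    rintro p ⟨g, rfl⟩
    obtain ⟨h, hhH, hh⟩ := hsurj g
    have ho : h o = f g := by rw [← hf1, hh, mul_one]
    have hcomm : Commute h (r⁻¹ * elemRefl μ rs2 o) :=
      Subgroup.mem_centralizer_singleton_iff.1 (hcent hhH)
    rw [← ho, elemRefl_mul_elemRefl_eq_commutator rs2 (hAut hhH) hcomm]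
    exact mul_mem (mul_mem (mul_mem hhH hrH) (inv_mem hhH)) (inv_mem hrH)
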